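/- arXiv:2502.14161 — 10 statements merged into one kernel-verified Lean document; each statement's English description precedes it below -/
import Mathlib

section
/- Let G be a finite simple graph, W a subset of V(G), and lab : W → {1,…,k} a labeling such that same-labeled vertices have the same neighbors outside W, i.e., for all v, v' ∈ W with lab(v) = lab(v') and all u ∈ V(G) ∖ W, if {v,u} is an edge of G then {v',u} is an edge of G. Let M be an induced matching of G and set S = V_M ∩ W. Then for every label i ∈ {1,…,k}, it cannot happen that S ∩ lab⁻¹(i) contains at least two vertices and some vertex of S ∩ lab⁻¹(i) has degree 0 in the induced subgraph G[S]; equivalently, either every vertex of S ∩ lab⁻¹(i) has degree 1 in G[S], or S ∩ lab⁻¹(i) contains at most one vertex. -/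
/-- `M` is a matching of `G`. -/
def IsMatchingSet {V : Type*} (G : SimpleGraph V) (M : Set (Sym2 V)) : Prop :=
  M ⊆ G.edgeSet ∧ ∀ e ∈ M, ∀ f ∈ M, e ≠ f → ∀ v : V, v ∈ e → v ∉ f

/-- `V_M`: the set of vertices incident with an edge of `M`. -/
def matchedVerts {V : Type*} (M : Set (Sym2 V)) : Set V := {v | ∃ e ∈ M, v ∈ e}

/-- The degree of `v` in the induced subgraph `G[S]`. -/
noncomputable def degIn {V : Type*} (G : SimpleGraph V) (S : Set V) (v : V) : ℕ :=
  {u | u ∈ S ∧ G.Adj v u}.ncard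

/-- `M` is an induced matching of `G`: a matching such that `G[V_M]` is 1-regular. -/
def IsInducedMatching {V : Type*} (G : SimpleGraph V) (M : Set (Sym2 V)) : Prop :=
  IsMatchingSet G M ∧ ∀ v ∈ matchedVerts M, degIn G (matchedVerts M) v = 1

/-- For an induced matching `M` and a labeling of `W ⊆ V(G)` where same-labeled vertices
have the same neighborhood outside `W`, no label class of `S = V_M ∩ W` can both contain
at least two vertices and contain a vertex of degree `0` in `G[S]`. -/
theorem inducedMatching_label_class_no_two_with_isolated
    {V : Type*} [Fintype V] {k : ℕ} (G : SimpleGraph V) (W : Set V) (lab : V → Fin k)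
    (hlab : ∀ v v' : V, v ∈ W → v' ∈ W → lab v = lab v' →
      ∀ u : V, u ∉ W → G.Adj v u → G.Adj v' u)
    (M : Set (Sym2 V)) (hM : IsInducedMatching G M) :
    ∀ i : Fin k,
      ¬ (∃ x y : V, x ∈ matchedVerts M ∩ W ∧ y ∈ matchedVerts M ∩ W ∧ x ≠ y ∧
            lab x = i ∧ lab y = i ∧
          ∃ v ∈ matchedVerts M ∩ W, lab v = i ∧ degIn G (matchedVerts M ∩ W) v = 0) := by
  rintro i ⟨x, y, hx, hy, hxy, hxi, hyi, v, hv, hvi, hdeg⟩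
  obtain ⟨w, hw, hwi, hwv⟩ : ∃ w ∈ matchedVerts M ∩ W, lab w = i ∧ w ≠ v := by
    by_cases h : x = v
    · exact ⟨y, hy, hyi, fun hyv => hxy (h.trans hyv.symm)⟩
    · exact ⟨x, hx, hxi, h⟩
  have hreg := hM.2
  unfold degIn at hdeg hreg
  rw [Set.ncard_eq_zero (Set.toFinite _)] at hdeg
  obtain ⟨u, hu⟩ := Set.ncard_eq_one.mp (hreg v hv.1)
  obtain ⟨huM, hvu⟩ : u ∈ matchedVerts M ∧ G.Adj v u :=
    hu.symm.subset (Set.mem_singleton u)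
  have huW : u ∉ W := fun h => hdeg.subset ⟨⟨huM, h⟩, hvu⟩
  have hwu : G.Adj w u := hlab v w hv.2 hw.2 (hvi.trans hwi.symm) u huW hvu
  exact hwv <| (Set.ncard_le_one (Set.toFinite _)).mp (hreg u huM).le
    w ⟨hw.1, hwu.symm⟩ v ⟨hv.1, hvu.symm⟩
end

section
/- Let H' be a k-labeled graph, let i ≠ j be labels such that H' has no edge joining an i-vertex to a j-vertex, and let H = η_{i,j}(H') be the k-labeled graph obtained from H' by adding all edges between vertices of label i and vertices of label j (vertices and labels unchanged). Let S ⊆ V(H') be a set whose signature sgn_{H'}(S) = σ' is defined. Then sgn_H(S) is defined and equal to a tuple σ if and only if f_{i,j}(σ') is defined and equal to σ, where f_{i,j} is the partial function on {0,1,2}^k with f_{i,j}(σ') = σ given by: σ(w) = σ'(w) for all w ∉ {i,j}; (σ(i),σ(j)) = (σ'(i),σ'(j)) if 0 ∈ {σ'(i),σ'(j)}; (σ(i),σ(j)) = (1,1) if σ'(i) = σ'(j) = 2; and f_{i,j}(σ') is undefined otherwise. -/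
/-- `sgn_{H,i}(S) = a`: the partial signature of `S` at label `i` is defined and equals `a`. -/
def sgnAtIs {V : Type*} {k : ℕ} (G : SimpleGraph V) (lab : V → Fin k) (S : Set V)
    (i : Fin k) (a : Fin 3) : Prop :=
  (a = 0 ∧ S ∩ {v | lab v = i} = ∅) ∨
  (a = 1 ∧ (S ∩ {v | lab v = i}).Nonempty ∧ ∀ v ∈ S ∩ {v | lab v = i}, degIn G S v = 1) ∨
  (a = 2 ∧ ∃ v : V, S ∩ {v' | lab v' = i} = {v} ∧ degIn G S v = 0)

/-- `sgn_H(S)` is defined and equals `σ`. -/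
def SgnIs {V : Type*} {k : ℕ} (G : SimpleGraph V) (lab : V → Fin k) (S : Set V)
    (σ : Fin k → Fin 3) : Prop :=
  ∀ i : Fin k, sgnAtIs G lab S i (σ i)

/-- The partial function `f_{i,j}` is defined at `σ'` with value `σ`. -/
def fRel {k : ℕ} (i j : Fin k) (σ' σ : Fin k → Fin 3) : Prop :=
  (∀ w : Fin k, w ≠ i → w ≠ j → σ w = σ' w) ∧
  (((σ' i = 0 ∨ σ' j = 0) ∧ σ i = σ' i ∧ σ j = σ' j) ∨
   ((σ' i = 2 ∧ σ' j = 2) ∧ σ i = 1 ∧ σ j = 1))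

theorem sgnAtIs_congr {V : Type*} {k : ℕ} {G G' : SimpleGraph V} {lab : V → Fin k} {S : Set V}
    {i : Fin k} (h : ∀ v ∈ S, lab v = i → degIn G S v = degIn G' S v) (a : Fin 3) :
    sgnAtIs G lab S i a ↔ sgnAtIs G' lab S i a := by
  unfold sgnAtIs
  refine or_congr Iff.rfl (or_congr ?_ ?_)
  · refine and_congr_right fun _ => and_congr_right fun _ => forall₂_congr fun v hv => ?_
    rw [h v hv.1 hv.2]
  · refine and_congr_right fun _ => exists_congr fun v => and_congr_right fun hv => ?_
    have hmem : v ∈ S ∩ {v' | lab v' = i} := hv ▸ Set.mem_singleton v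
    rw [h v hmem.1 hmem.2]

theorem sgnAtIs.unique {V : Type*} {k : ℕ} {G : SimpleGraph V} {lab : V → Fin k} {S : Set V}
    {i : Fin k} {a b : Fin 3} (ha : sgnAtIs G lab S i a) (hb : sgnAtIs G lab S i b) : a = b := by
  rcases ha with ⟨rfl, ha⟩ | ⟨rfl, ha, hd⟩ | ⟨rfl, v, ha, hd⟩ <;>
  rcases hb with ⟨rfl, hb⟩ | ⟨rfl, hb, he⟩ | ⟨rfl, w, hb, he⟩ <;> simp_all

theorem sgnAtIs.eq_zero_iff {V : Type*} {k : ℕ} {G : SimpleGraph V} {lab : V → Fin k} {S : Set V}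
    {i : Fin k} {a : Fin 3} (ha : sgnAtIs G lab S i a) :
    a = 0 ↔ S ∩ {v | lab v = i} = ∅ := by
  rcases ha with ⟨rfl, ha⟩ | ⟨rfl, ha, -⟩ | ⟨rfl, v, ha, -⟩
  · simp [ha]
  · simp [ha.ne_empty]
  · simp [ha]

theorem sgnAtIs.ncard_eq_one {V : Type*} {k : ℕ} {G : SimpleGraph V} {lab : V → Fin k} {S : Set V}
    {i : Fin k} (h : sgnAtIs G lab S i 2) : (S ∩ {v | lab v = i}).ncard = 1 := by
  rcases h with ⟨h, -⟩ | ⟨h, -⟩ | ⟨-, v, h, -⟩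
  · simp at h
  · simp at h
  · simp [h]

/-- Raising all degrees at label `i` by the same positive amount keeps the signature at `i`
defined only if it was `2` and the degrees are raised by one. -/
theorem sgnAtIs_iff_of_degIn_eq_add {V : Type*} {k : ℕ} {G G' : SimpleGraph V} {lab : V → Fin k}
    {S : Set V} {i : Fin k} {m : ℕ} (hm : m ≠ 0)
    (h : ∀ v ∈ S, lab v = i → degIn G S v = degIn G' S v + m) {a' : Fin 3}
    (ha' : sgnAtIs G' lab S i a') (hne : a' ≠ 0) (a : Fin 3) :
    sgnAtIs G lab S i a ↔ a = 1 ∧ a' = 2 ∧ m = 1 := by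
  constructor
  · have hS : (S ∩ {v | lab v = i}).Nonempty :=
      Set.nonempty_iff_ne_empty.2 fun h0 => hne (ha'.eq_zero_iff.2 h0)
    rintro (⟨-, h0⟩ | ⟨rfl, ⟨v, hv⟩, hd⟩ | ⟨-, v, hv, hd⟩)
    · exact absurd h0 hS.ne_empty
    · have h1 := hd v hv
      rw [h v hv.1 hv.2] at h1
      refine ⟨rfl, ?_, by omega⟩
      rcases ha' with ⟨h0, -⟩ | ⟨-, -, hd'⟩ | ⟨h2, -⟩
      · exact absurd h0 hne
      · have := hd' v hv
        omega
      · exact h2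
    · have hmem : v ∈ S ∩ {v' | lab v' = i} := hv ▸ Set.mem_singleton v
      have := h v hmem.1 hmem.2
      omega
  · rintro ⟨rfl, rfl, rfl⟩
    rcases ha' with ⟨h0, -⟩ | ⟨h1, -⟩ | ⟨-, v, hv, hd⟩
    · simp at h0
    · simp at h1
    · have hmem : v ∈ S ∩ {v' | lab v' = i} := hv ▸ Set.mem_singleton v
      refine Or.inr (Or.inl ⟨rfl, ⟨v, hmem⟩, fun w hw => ?_⟩)
      obtain rfl : w = v := by simpa [hv] using hw
      rw [h w hw.1 hw.2, hd]

theorem degIn_eq_add_ncard {V : Type*} [Finite V] {G G' : SimpleGraph V} {S T : Set V} {v : V}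
    (hG : ∀ u, G.Adj v u ↔ G'.Adj v u ∨ u ∈ T) (hT : ∀ u ∈ T, ¬ G'.Adj v u) :
    degIn G S v = degIn G' S v + (S ∩ T).ncard := by
  unfold degIn
  rw [← Set.ncard_union_eq (Set.disjoint_left.2 fun u hu hu' => hT u hu'.2 hu.2)
    (Set.toFinite _) (Set.toFinite _)]
  congr 1
  ext u
  simp only [Set.mem_ofPred_eq, Set.mem_union, Set.mem_inter_iff, hG]
  tauto

/-- Effect of the join operation `η_{i,j}` on signatures: for an irredundant join,
`sgn_H(S)` is defined and equals `σ` iff `f_{i,j}(σ')` is defined and equals `σ`. -/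
theorem sgn_join {V : Type*} [Fintype V] {k : ℕ} (H' H : SimpleGraph V)
    (lab : V → Fin k) (i j : Fin k) (hij : i ≠ j)
    (hirred : ∀ u v : V, lab u = i → lab v = j → ¬ H'.Adj u v)
    (hH : ∀ u v : V, H.Adj u v ↔ H'.Adj u v ∨
      (u ≠ v ∧ ((lab u = i ∧ lab v = j) ∨ (lab u = j ∧ lab v = i))))
    (S : Set V) (σ' σ : Fin k → Fin 3) (hS : SgnIs H' lab S σ') :
    SgnIs H lab S σ ↔ fRel i j σ' σ := by
  have hdi : ∀ v ∈ S, lab v = i →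
      degIn H S v = degIn H' S v + (S ∩ {u | lab u = j}).ncard := by
    intro v _ hv
    refine degIn_eq_add_ncard (fun u => ?_) fun u hu => hirred v u hv hu
    rw [hH, Set.mem_ofPred_eq]
    grind
  have hdj : ∀ v ∈ S, lab v = j →
      degIn H S v = degIn H' S v + (S ∩ {u | lab u = i}).ncard := by
    intro v _ hv
    refine degIn_eq_add_ncard (fun u => ?_) fun u hu h => hirred u v hu hv h.symm
    rw [hH, Set.mem_ofPred_eq]
    grind
  have hother : ∀ w, w ≠ i → w ≠ j → (sgnAtIs H lab S w (σ w) ↔ σ w = σ' w) := by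
    intro w hwi hwj
    rw [sgnAtIs_congr (G' := H') fun v _ hv => ?_]
    · exact ⟨fun h => h.unique (hS w), fun h => h ▸ hS w⟩
    · unfold degIn
      simp only [hH, hv, hwi, hwj, false_and, or_false, and_false]
  have hsplit : SgnIs H lab S σ ↔ (∀ w, w ≠ i → w ≠ j → σ w = σ' w) ∧
      sgnAtIs H lab S i (σ i) ∧ sgnAtIs H lab S j (σ j) := by
    constructor
    · exact fun h => ⟨fun w hi hj => (hother w hi hj).1 (h w), h i, h j⟩
    · rintro ⟨h, hi, hj⟩ w
      by_cases hwi : w = i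
      · exact hwi ▸ hi
      by_cases hwj : w = j
      · exact hwj ▸ hj
      exact (hother w hwi hwj).2 (h w hwi hwj)
  rw [hsplit, fRel]
  refine and_congr_right fun _ => ?_
  by_cases h0 : σ' i = 0 ∨ σ' j = 0
  · have hi : sgnAtIs H lab S i (σ i) ↔ σ i = σ' i := by
      rw [sgnAtIs_congr (G' := H') fun v hvS hv => ?_]
      · exact ⟨fun h => h.unique (hS i), fun h => h ▸ hS i⟩
      · rcases h0 with h0 | h0
        · exact absurd ((hS i).eq_zero_iff.1 h0) (Set.Nonempty.ne_empty ⟨v, hvS, hv⟩)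
        · rw [hdi v hvS hv, (hS j).eq_zero_iff.1 h0, Set.ncard_empty, add_zero]
    have hj : sgnAtIs H lab S j (σ j) ↔ σ j = σ' j := by
      rw [sgnAtIs_congr (G' := H') fun v hvS hv => ?_]
      · exact ⟨fun h => h.unique (hS j), fun h => h ▸ hS j⟩
      · rcases h0 with h0 | h0
        · rw [hdj v hvS hv, (hS i).eq_zero_iff.1 h0, Set.ncard_empty, add_zero]
        · exact absurd ((hS j).eq_zero_iff.1 h0) (Set.Nonempty.ne_empty ⟨v, hvS, hv⟩)
    rw [hi, hj]
    refine ⟨fun h => Or.inl ⟨h0, h⟩, ?_⟩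
    rintro (⟨-, h⟩ | ⟨⟨h2, h2'⟩, -⟩)
    · exact h
    · simp [h2, h2'] at h0
  · obtain ⟨hi0, hj0⟩ := not_or.1 h0
    have hci : (S ∩ {u | lab u = i}).ncard ≠ 0 := by
      rwa [Ne, Set.ncard_eq_zero, ← (hS i).eq_zero_iff]
    have hcj : (S ∩ {u | lab u = j}).ncard ≠ 0 := by
      rwa [Ne, Set.ncard_eq_zero, ← (hS j).eq_zero_iff]
    rw [sgnAtIs_iff_of_degIn_eq_add hcj hdi (hS i) hi0,
      sgnAtIs_iff_of_degIn_eq_add hci hdj (hS j) hj0]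
    constructor
    · rintro ⟨⟨hi, hi', -⟩, hj, hj', -⟩
      exact Or.inr ⟨⟨hi', hj'⟩, hi, hj⟩
    · rintro (⟨h, -⟩ | ⟨⟨hi', hj'⟩, hi, hj⟩)
      · exact absurd h h0
      · exact ⟨⟨hi, hi', (hj' ▸ hS j).ncard_eq_one⟩, hj, hj', (hi' ▸ hS i).ncard_eq_one⟩
end

section
/- Let H' be a k-labeled graph, let i ≠ j be labels, and let H = ρ_{i→j}(H') be the k-labeled graph with the same underlying graph as H' in which every vertex of label i is relabeled to label j (all other labels unchanged). Let S ⊆ V(H') be a set whose signature sgn_{H'}(S) = σ' is defined. Then sgn_H(S) is defined and equal to a tuple σ if and only if g_{i→j}(σ') is defined and equal to σ, where g_{i→j} is the partial function on {0,1,2}^k with g_{i→j}(σ') = σ given by: σ(w) = σ'(w) for all w ∉ {i,j}; σ(i) = 0; σ(j) = max{σ'(i), σ'(j)} if 0 ∈ {σ'(i), σ'(j)}; σ(j) = 1 if σ'(i) = σ'(j) = 1; and g_{i→j}(σ') is undefined otherwise. -/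
/-- The partial function `g_{i→j}` is defined at `σ'` with value `σ`. -/
def gRel {k : ℕ} (i j : Fin k) (σ' σ : Fin k → Fin 3) : Prop :=
  (∀ w : Fin k, w ≠ i → w ≠ j → σ w = σ' w) ∧ σ i = 0 ∧
  (((σ' i = 0 ∨ σ' j = 0) ∧ σ j = max (σ' i) (σ' j)) ∨
   ((σ' i = 1 ∧ σ' j = 1) ∧ σ j = 1))

/-- The signature value `a` of a set `A` of selected vertices sharing a label, where `d` gives the
degrees in the subgraph induced by the whole selection. -/
def ClassSgnIs {V : Type*} (d : V → ℕ) (A : Set V) (a : Fin 3) : Prop :=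
  (a = 0 ∧ A = ∅) ∨
  (a = 1 ∧ A.Nonempty ∧ ∀ v ∈ A, d v = 1) ∨
  (a = 2 ∧ ∃ v : V, A = {v} ∧ d v = 0)

theorem sgnAtIs_iff_classSgnIs {V : Type*} {k : ℕ} (G : SimpleGraph V) (lab : V → Fin k)
    (S : Set V) (i : Fin k) (a : Fin 3) :
    sgnAtIs G lab S i a ↔ ClassSgnIs (degIn G S) (S ∩ {v | lab v = i}) a :=
  Iff.rfl

theorem ClassSgnIs.unique {V : Type*} {d : V → ℕ} {A : Set V} {a b : Fin 3}
    (ha : ClassSgnIs d A a) (hb : ClassSgnIs d A b) : a = b := by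
  rcases ha with ⟨rfl, hA⟩ | ⟨rfl, hA, hd⟩ | ⟨rfl, v, hA, hd⟩ <;>
  rcases hb with ⟨rfl, hB⟩ | ⟨rfl, hB, he⟩ | ⟨rfl, w, hB, he⟩ <;>
  simp_all

theorem ClassSgnIs.iff_eq {V : Type*} {d : V → ℕ} {A : Set V} {a b : Fin 3}
    (ha : ClassSgnIs d A a) : ClassSgnIs d A b ↔ b = a :=
  ⟨fun hb => hb.unique ha, fun h => h ▸ ha⟩

theorem classSgnIs_empty {V : Type*} (d : V → ℕ) : ClassSgnIs d ∅ 0 :=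
  Or.inl ⟨rfl, rfl⟩

/-- A class containing a vertex of degree zero has no signature unless it is a singleton. -/
theorem ClassSgnIs.eq_of_degree_zero {V : Type*} {d : V → ℕ} {A : Set V} {a : Fin 3} {v w : V}
    (h : ClassSgnIs d A a) (hv : v ∈ A) (hd : d v = 0) (hw : w ∈ A) : w = v := by
  rcases h with ⟨-, rfl⟩ | ⟨-, -, h⟩ | ⟨-, u, rfl, -⟩
  · exact hv.elim
  · simp [h v hv] at hd
  · exact hw.trans hv.symm

theorem classSgnIs_union_iff {V : Type*} {d : V → ℕ} {A B : Set V} {a b c : Fin 3}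
    (hAB : Disjoint A B) (hA : ClassSgnIs d A a) (hB : ClassSgnIs d B b) :
    ClassSgnIs d (A ∪ B) c ↔
      ((a = 0 ∨ b = 0) ∧ c = max a b) ∨ ((a = 1 ∧ b = 1) ∧ c = 1) := by
  have hA' := hA
  have hB' := hB
  rcases hA with ⟨rfl, rfl⟩ | ⟨rfl, hAne, hAd⟩ | ⟨rfl, v, rfl, hv⟩
  · simp [hB.iff_eq]
  · rcases hB with ⟨rfl, rfl⟩ | ⟨rfl, -, hBd⟩ | ⟨rfl, w, rfl, hw⟩
    · simp [hA'.iff_eq]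
    · have h : ClassSgnIs d (A ∪ B) 1 :=
        Or.inr (Or.inl ⟨rfl, hAne.inl, fun v hv => hv.elim (hAd v) (hBd v)⟩)
      simp [h.iff_eq]
    · refine iff_of_false (fun h => ?_) (by simp)
      obtain ⟨x, hx⟩ := hAne
      exact hAB.ne_of_mem hx rfl (h.eq_of_degree_zero (Or.inr rfl) hw (Or.inl hx))
  · rcases hB with ⟨rfl, rfl⟩ | ⟨rfl, ⟨x, hx⟩, -⟩ | ⟨rfl, w, rfl, -⟩
    · simp [hA'.iff_eq]
    · refine iff_of_false (fun h => ?_) (by simp)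
      exact hAB.ne_of_mem rfl hx (h.eq_of_degree_zero (Or.inl rfl) hv (Or.inr hx)).symm
    · refine iff_of_false (fun h => ?_) (by simp)
      exact hAB.ne_of_mem rfl rfl (h.eq_of_degree_zero (Or.inl rfl) hv (Or.inr rfl)).symm

/-- Effect of the relabel operation `ρ_{i→j}` on signatures:
`sgn_H(S)` is defined and equals `σ` iff `g_{i→j}(σ')` is defined and equals `σ`. -/
theorem sgn_relabel {V : Type*} [Fintype V] {k : ℕ} (G : SimpleGraph V)
    (lab : V → Fin k) (i j : Fin k) (hij : i ≠ j)
    (S : Set V) (σ' σ : Fin k → Fin 3) (hS : SgnIs G lab S σ') :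
    SgnIs G (fun v => if lab v = i then j else lab v) S σ ↔ gRel i j σ' σ := by
  have hother : ∀ w, w ≠ i → w ≠ j →
      (sgnAtIs G (fun v => if lab v = i then j else lab v) S w (σ w) ↔ σ w = σ' w) := by
    intro w hwi hwj
    have hset : S ∩ {v | (if lab v = i then j else lab v) = w} = S ∩ {v | lab v = w} := by
      ext v
      simp only [Set.mem_inter_iff, Set.mem_ofPred_eq]
      grind
    rw [sgnAtIs_iff_classSgnIs, hset]
    exact ClassSgnIs.iff_eq (hS w)
  have hi : sgnAtIs G (fun v => if lab v = i then j else lab v) S i (σ i) ↔ σ i = 0 := by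
    have hset : S ∩ {v | (if lab v = i then j else lab v) = i} = ∅ := by
      ext v
      simp only [Set.mem_inter_iff, Set.mem_ofPred_eq, Set.mem_empty_iff_false]
      grind
    rw [sgnAtIs_iff_classSgnIs, hset]
    exact (classSgnIs_empty _).iff_eq
  have hj : sgnAtIs G (fun v => if lab v = i then j else lab v) S j (σ j) ↔
      ((σ' i = 0 ∨ σ' j = 0) ∧ σ j = max (σ' i) (σ' j)) ∨
        ((σ' i = 1 ∧ σ' j = 1) ∧ σ j = 1) := by
    have hset : S ∩ {v | (if lab v = i then j else lab v) = j} =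
        (S ∩ {v | lab v = i}) ∪ (S ∩ {v | lab v = j}) := by
      ext v
      simp only [Set.mem_inter_iff, Set.mem_union, Set.mem_ofPred_eq]
      grind
    rw [sgnAtIs_iff_classSgnIs, hset]
    refine classSgnIs_union_iff ?_ (hS i) (hS j)
    exact Set.disjoint_left.2 fun v hvi hvj => hij (hvi.2.symm.trans hvj.2)
  constructor
  · intro h
    exact ⟨fun w hwi hwj => (hother w hwi hwj).1 (h w), hi.1 (h i), hj.1 (h j)⟩
  · rintro ⟨h, h0, hmax⟩ w
    rcases eq_or_ne w i with rfl | hwi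
    · exact hi.2 h0
    rcases eq_or_ne w j with rfl | hwj
    · exact hj.2 hmax
    · exact (hother w hwi hwj).2 (h w hwi hwj)
end

section
/- Let H = H₁ ⊕ H₂ be the disjoint union of two k-labeled graphs H₁ and H₂ (labels preserved). Let S ⊆ V(H) be a partial matching of H whose signature σ = sgn_H(S) is defined, and set S₁ = S ∩ V(H₁) and S₂ = S ∩ V(H₂). Then the signatures σ₁ = sgn_{H₁}(S₁) and σ₂ = sgn_{H₂}(S₂) are defined, and for all labels w ∈ {1,…,k}: σ(w) = 0 if and only if σ₁(w) = σ₂(w) = 0; σ(w) = 1 if and only if (σ₁(w),σ₂(w)) ∈ {(0,1),(1,0),(1,1)}; and σ(w) = 2 if and only if (σ₁(w),σ₂(w)) ∈ {(0,2),(2,0)}. -/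
theorem sgnAtIs_zero_iff {V : Type*} {k : ℕ} {G : SimpleGraph V} {lab : V → Fin k} {S : Set V}
    {i : Fin k} : sgnAtIs G lab S i 0 ↔ ∀ v ∈ S, lab v ≠ i := by
  simp [sgnAtIs, Set.eq_empty_iff_forall_notMem]

theorem sgnAtIs_one_iff {V : Type*} {k : ℕ} {G : SimpleGraph V} {lab : V → Fin k} {S : Set V}
    {i : Fin k} : sgnAtIs G lab S i 1 ↔
      (∃ v ∈ S, lab v = i) ∧ ∀ v ∈ S, lab v = i → degIn G S v = 1 := by
  simp [sgnAtIs, Set.Nonempty]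

theorem sgnAtIs_two_iff {V : Type*} {k : ℕ} {G : SimpleGraph V} {lab : V → Fin k} {S : Set V}
    {i : Fin k} : sgnAtIs G lab S i 2 ↔
      ∃ v ∈ S, lab v = i ∧ degIn G S v = 0 ∧ ∀ u ∈ S, lab u = i → u = v := by
  simp only [sgnAtIs, Set.eq_singleton_iff_unique_mem, Set.mem_inter_iff, Set.mem_ofPred_eq]
  constructor
  · rintro (⟨h, _⟩ | ⟨h, _⟩ | ⟨_, v, ⟨⟨hv, hi⟩, hu⟩, hd⟩)
    · simp at h
    · simp at h
    · exact ⟨v, hv, hi, hd, fun u hS hl => hu u ⟨hS, hl⟩⟩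
  · rintro ⟨v, hv, hi, hd, hu⟩
    exact Or.inr (Or.inr ⟨trivial, v, ⟨⟨hv, hi⟩, fun u h => hu u h.1 h.2⟩, hd⟩)

/-- Degrees in induced subgraphs are preserved by an embedding whose image is closed under
adjacency. -/
theorem degIn_preimage {V W : Type*} {G : SimpleGraph V} {H : SimpleGraph W} {f : V → W}
    (hf : Function.Injective f) {v : V}
    (h : ∀ w, H.Adj (f v) w ↔ ∃ u, f u = w ∧ G.Adj v u) (S : Set W) :
    degIn G (f ⁻¹' S) v = degIn H S (f v) := by
  rw [degIn, degIn, ← Set.ncard_image_of_injective _ hf]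
  congr 1
  ext w
  simp only [Set.mem_image, Set.mem_ofPred_eq, Set.mem_preimage, h]
  constructor
  · rintro ⟨u, ⟨hu, ha⟩, rfl⟩
    exact ⟨hu, u, rfl, ha⟩
  · rintro ⟨hw, u, rfl, ha⟩
    exact ⟨u, ⟨hw, ha⟩, rfl⟩

/-- Decomposition of signatures over a disjoint union `H = H₁ ⊕ H₂`. -/
theorem sgn_disjoint_union {V₁ V₂ : Type*} [Fintype V₁] [Fintype V₂] {k : ℕ}
    (H₁ : SimpleGraph V₁) (H₂ : SimpleGraph V₂) (lab₁ : V₁ → Fin k) (lab₂ : V₂ → Fin k)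
    (H : SimpleGraph (V₁ ⊕ V₂))
    (hH : ∀ u v : V₁ ⊕ V₂, H.Adj u v ↔
      ((∃ a b, u = Sum.inl a ∧ v = Sum.inl b ∧ H₁.Adj a b) ∨
       (∃ a b, u = Sum.inr a ∧ v = Sum.inr b ∧ H₂.Adj a b)))
    (S : Set (V₁ ⊕ V₂))
    (hpm : ∀ v ∈ S, degIn H S v ≤ 1)
    (σ : Fin k → Fin 3) (hσ : SgnIs H (Sum.elim lab₁ lab₂) S σ) :
    ∃ σ₁ σ₂ : Fin k → Fin 3,
      SgnIs H₁ lab₁ (Sum.inl ⁻¹' S) σ₁ ∧ SgnIs H₂ lab₂ (Sum.inr ⁻¹' S) σ₂ ∧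
      ∀ w : Fin k,
        (σ w = 0 ↔ (σ₁ w = 0 ∧ σ₂ w = 0)) ∧
        (σ w = 1 ↔ ((σ₁ w = 0 ∧ σ₂ w = 1) ∨ (σ₁ w = 1 ∧ σ₂ w = 0) ∨
            (σ₁ w = 1 ∧ σ₂ w = 1))) ∧
        (σ w = 2 ↔ ((σ₁ w = 0 ∧ σ₂ w = 2) ∨ (σ₁ w = 2 ∧ σ₂ w = 0))) := by
  have d₁ (a : V₁) : degIn H₁ (Sum.inl ⁻¹' S) a = degIn H S (Sum.inl a) :=
    degIn_preimage Sum.inl_injective (fun w => by rw [hH]; cases w <;> simp) S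
  have d₂ (b : V₂) : degIn H₂ (Sum.inr ⁻¹' S) b = degIn H S (Sum.inr b) :=
    degIn_preimage Sum.inr_injective (fun w => by rw [hH]; cases w <;> simp) S
  suffices key : ∀ w : Fin k, ∃ a b : Fin 3, sgnAtIs H₁ lab₁ (Sum.inl ⁻¹' S) w a ∧
      sgnAtIs H₂ lab₂ (Sum.inr ⁻¹' S) w b ∧
      (σ w = 0 ↔ (a = 0 ∧ b = 0)) ∧
      (σ w = 1 ↔ ((a = 0 ∧ b = 1) ∨ (a = 1 ∧ b = 0) ∨ (a = 1 ∧ b = 1))) ∧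
      (σ w = 2 ↔ ((a = 0 ∧ b = 2) ∨ (a = 2 ∧ b = 0))) by
    choose σ₁ σ₂ h₁ h₂ h using key
    exact ⟨σ₁, σ₂, h₁, h₂, h⟩
  intro w
  have hw := hσ w
  generalize σ w = c at hw
  have hc : c = 0 ∨ c = 1 ∨ c = 2 := by fin_cases c <;> simp
  rcases hc with rfl | rfl | rfl
  · rw [sgnAtIs_zero_iff] at hw
    exact ⟨0, 0, sgnAtIs_zero_iff.2 fun a ha => hw (Sum.inl a) ha,
      sgnAtIs_zero_iff.2 fun b hb => hw (Sum.inr b) hb, by decide⟩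
  · rw [sgnAtIs_one_iff] at hw
    obtain ⟨⟨v, hv, hl⟩, hd⟩ := hw
    have e₁ : ∀ a ∈ Sum.inl ⁻¹' S, lab₁ a = w → degIn H₁ (Sum.inl ⁻¹' S) a = 1 :=
      fun a ha hl => (d₁ a).trans (hd (Sum.inl a) ha hl)
    have e₂ : ∀ b ∈ Sum.inr ⁻¹' S, lab₂ b = w → degIn H₂ (Sum.inr ⁻¹' S) b = 1 :=
      fun b hb hl => (d₂ b).trans (hd (Sum.inr b) hb hl)
    by_cases n₁ : ∃ a ∈ Sum.inl ⁻¹' S, lab₁ a = w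
    · by_cases n₂ : ∃ b ∈ Sum.inr ⁻¹' S, lab₂ b = w
      · exact ⟨1, 1, sgnAtIs_one_iff.2 ⟨n₁, e₁⟩, sgnAtIs_one_iff.2 ⟨n₂, e₂⟩, by decide⟩
      · exact ⟨1, 0, sgnAtIs_one_iff.2 ⟨n₁, e₁⟩,
          sgnAtIs_zero_iff.2 fun b hb hl => n₂ ⟨b, hb, hl⟩, by decide⟩
    · have n₂ : ∃ b ∈ Sum.inr ⁻¹' S, lab₂ b = w := by
        cases v with
        | inl a => exact absurd ⟨a, hv, hl⟩ n₁
        | inr b => exact ⟨b, hv, hl⟩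
      exact ⟨0, 1, sgnAtIs_zero_iff.2 fun a ha hl => n₁ ⟨a, ha, hl⟩,
        sgnAtIs_one_iff.2 ⟨n₂, e₂⟩, by decide⟩
  · rw [sgnAtIs_two_iff] at hw
    obtain ⟨v, hv, hl, hd, hu⟩ := hw
    cases v with
    | inl a =>
      exact ⟨2, 0, sgnAtIs_two_iff.2 ⟨a, hv, hl, (d₁ a).trans hd,
          fun u hS hl => Sum.inl_injective (hu (Sum.inl u) hS hl)⟩,
        sgnAtIs_zero_iff.2 fun b hb hl => Sum.inr_ne_inl (hu (Sum.inr b) hb hl), by decide⟩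
    | inr b =>
      exact ⟨0, 2, sgnAtIs_zero_iff.2 fun a ha hl => Sum.inl_ne_inr (hu (Sum.inl a) ha hl),
        sgnAtIs_two_iff.2 ⟨b, hv, hl, (d₂ b).trans hd,
          fun u hS hl => Sum.inr_injective (hu (Sum.inr u) hS hl)⟩, by decide⟩
end

section
/- Let G be a finite simple graph and M an acyclic matching of G. Suppose {u,v} ∈ M, and let l be a vertex with l ≠ v whose only neighbor in G is u (i.e., l is a leaf attached to u). Then M' = (M ∖ {{u,v}}) ∪ {{u,l}} is an acyclic matching of G with |M'| = |M|. -/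
/-- `M` is an acyclic matching of `G`: a matching such that `G[V_M]` is acyclic. -/
def IsAcyclicMatching {V : Type*} (G : SimpleGraph V) (M : Set (Sym2 V)) : Prop :=
  IsMatchingSet G M ∧ (G.induce (matchedVerts M)).IsAcyclic

namespace SimpleGraph

variable {V : Type*} {G : SimpleGraph V}

lemma isAcyclic_induce_iff {s : Set V} :
    (G.induce s).IsAcyclic ↔
      ∀ ⦃a : V⦄ (c : G.Walk a a), c.IsCycle → ¬ ∀ x ∈ c.support, x ∈ s := by
  refine ⟨fun h a c hc hs ↦ h (c.induce s hs) ?_, fun h a c hc ↦ ?_⟩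
  · refine Walk.IsCycle.of_map (f := (Embedding.induce s).toHom) ?_
    rwa [Walk.map_induce]
  · refine h (c.map (Embedding.induce s).toHom)
      (hc.map (Embedding.induce (G := G) s).injective) fun x hx ↦ ?_
    rw [Walk.support_map, List.mem_map] at hx
    obtain ⟨y, -, rfl⟩ := hx
    exact y.2

lemma Walk.IsCycle.notMem_support_of_adj_unique {a l u : V} {c : G.Walk a a} (hc : c.IsCycle)
    (hl : ∀ x, G.Adj l x → x = u) : l ∉ c.support := by
  classical
  intro h
  have hr := hc.rotate h
  refine hr.snd_ne_penultimate ?_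
  rw [hl _ (Walk.adj_snd hr.not_nil), hl _ (Walk.adj_penultimate hr.not_nil).symm]

end SimpleGraph

lemma IsMatchingSet.eq_of_mem {V : Type*} {G : SimpleGraph V} {M : Set (Sym2 V)}
    (hM : IsMatchingSet G M) {e f : Sym2 V} (he : e ∈ M) (hf : f ∈ M) {x : V}
    (hxe : x ∈ e) (hxf : x ∈ f) : e = f := by
  by_contra hne
  exact hM.2 e he f hf hne x hxe hxf

/-- A leaf attached to `u` is unmatched if `u` is matched to another vertex. -/
lemma IsMatchingSet.leaf_notMem_matchedVerts {V : Type*} {G : SimpleGraph V} {M : Set (Sym2 V)}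
    (hM : IsMatchingSet G M) {u v l : V} (huv : s(u, v) ∈ M) (hlv : l ≠ v)
    (hl : ∀ x, G.Adj l x → x = u) : l ∉ matchedVerts M := by
  rintro ⟨e, he, hle⟩
  obtain ⟨x, rfl⟩ := Sym2.mem_iff_exists.mp hle
  obtain rfl := hl x (hM.1 he)
  have h := hM.eq_of_mem he huv (Sym2.mem_mk_right l x) (Sym2.mem_mk_left x v)
  rw [Sym2.eq_swap, Sym2.congr_right] at h
  exact hlv h

/-- Exchanging a matching edge `{u,v}` for the pendant edge `{u,l}`, where `l` is a leaf
attached to `u`, preserves being an acyclic matching and the size. -/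
theorem acyclicMatching_swap_leaf {V : Type*} [Fintype V] (G : SimpleGraph V)
    (M : Set (Sym2 V)) (hM : IsAcyclicMatching G M) (u v l : V)
    (huv : s(u, v) ∈ M) (hlv : l ≠ v)
    (hleaf : ∀ x : V, G.Adj l x ↔ x = u) :
    IsAcyclicMatching G ((M \ {s(u, v)}) ∪ {s(u, l)}) ∧
      ((M \ {s(u, v)}) ∪ {s(u, l)}).ncard = M.ncard := by
  have hadj : G.Adj u l := ((hleaf u).mpr rfl).symm
  have hl : ∀ x, G.Adj l x → x = u := fun x ↦ (hleaf x).mp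
  obtain ⟨hmatch, hacyc⟩ := hM
  have hlM : l ∉ matchedVerts M := hmatch.leaf_notMem_matchedVerts huv hlv hl
  have hdisj : ∀ e ∈ M, e ≠ s(u, v) → ∀ x ∈ e, x ∉ s(u, l) := by
    intro e he hne x hxe hx
    rcases Sym2.mem_iff.mp hx with rfl | rfl
    · exact hne (hmatch.eq_of_mem he huv hxe (Sym2.mem_mk_left x v))
    · exact hlM ⟨e, he, hxe⟩
  refine ⟨⟨⟨?_, ?_⟩, ?_⟩, ?_⟩
  · rintro e (⟨he, -⟩ | rfl)
    · exact hmatch.1 he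
    · exact hadj
  · rintro e (⟨he, hne⟩ | rfl) f (⟨hf, hnf⟩ | rfl) hef x hxe hxf
    · exact hmatch.2 e he f hf hef x hxe hxf
    · exact hdisj e he hne x hxe hxf
    · exact hdisj f hf hnf x hxf hxe
    · exact hef rfl
  · rw [SimpleGraph.isAcyclic_induce_iff] at hacyc ⊢
    intro a c hc hs
    refine hacyc c hc fun x hx ↦ ?_
    obtain ⟨e, ⟨he, -⟩ | rfl, hxe⟩ := hs x hx
    · exact ⟨e, he, hxe⟩
    · rcases Sym2.mem_iff.mp hxe with rfl | rfl
      · exact ⟨_, huv, Sym2.mem_mk_left x v⟩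
      · exact absurd hx (hc.notMem_support_of_adj_unique hl)
  · rw [Set.union_singleton]
    exact Set.ncard_exchange (fun h ↦ hlM ⟨_, h, Sym2.mem_mk_right u l⟩) huv
end

section
/- Let G be a finite simple graph containing four distinct vertices v₁, v₂, p₁, p₂ such that {v₁,v₂}, {v₁,p₁}, {p₁,p₂}, {p₂,v₂} are edges of G, the only neighbors of p₁ in G are v₁ and p₂, and the only neighbors of p₂ in G are p₁ and v₂ (that is, v₁, v₂, p₁, p₂ form a XOR gadget with private vertices p₁, p₂). Let M be an acyclic matching of G of maximum size. Then there exists an acyclic matching M' of G with |M'| = |M| such that {p₁,p₂} ∈ M' and at most one of v₁, v₂ belongs to V_{M'}. -/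
theorem acyclic_induce_iff {V : Type*} {G : SimpleGraph V} {S : Set V} :
    (G.induce S).IsAcyclic ↔
      ∀ (v : V) (c : G.Walk v v), c.IsCycle → ∃ x ∈ c.support, x ∉ S := by
  refine ⟨fun h v c hc => ?_, fun h v c hc => ?_⟩
  · by_contra! hS
    refine h (c.induce S hS) (.of_map (f := (SimpleGraph.Embedding.induce S).toHom) ?_)
    rwa [SimpleGraph.Walk.map_induce]
  · obtain ⟨x, hx, hxS⟩ := h v (c.map (SimpleGraph.Embedding.induce S).toHom)
      (hc.map (SimpleGraph.Embedding.induce (G := G) S).injective)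
    obtain ⟨y, -, rfl⟩ := List.mem_map.1 (SimpleGraph.Walk.support_map _ c ▸ hx)
    exact hxS y.2

/-- Every vertex of a cycle has two distinct neighbours on the cycle. -/
theorem SimpleGraph.Walk.IsCycle.exists_adj_ne {V : Type*} {G : SimpleGraph V} {v x : V}
    {c : G.Walk v v} (hc : c.IsCycle) (hx : x ∈ c.support) (a : V) :
    ∃ y ∈ c.support, G.Adj x y ∧ y ≠ a := by
  obtain ⟨y, hy, hya⟩ := Set.exists_ne_of_one_lt_ncard
    (by rw [hc.ncard_neighborSet_toSubgraph_eq_two hx]; norm_num) a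
  exact ⟨y, (SimpleGraph.Walk.mem_verts_toSubgraph c).1 (c.toSubgraph.edge_vert hy.symm),
    c.toSubgraph.adj_sub hy, hya⟩

theorem exists_cycle_four {V : Type*} {G : SimpleGraph V} {a b c d : V} (hac : a ≠ c) (hbd : b ≠ d)
    (hab : G.Adj a b) (hbc : G.Adj b c) (hcd : G.Adj c d) (hda : G.Adj d a) :
    ∃ w : G.Walk a a, w.IsCycle ∧ ∀ x ∈ w.support, x = a ∨ x = b ∨ x = c ∨ x = d := by
  refine ⟨.cons hab (.cons hbc (.cons hcd (.cons hda .nil))), ?_, by simp⟩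
  have := hab.ne
  have := hbc.ne
  have := hcd.ne
  have := hda.ne
  simp [SimpleGraph.Walk.isCycle_def, SimpleGraph.Walk.isTrail_def]
  grind

theorem matchedVerts_insert {V : Type*} (M : Set (Sym2 V)) (e : Sym2 V) (x : V) :
    x ∈ matchedVerts (insert e M) ↔ x ∈ e ∨ x ∈ matchedVerts M := by
  simp [matchedVerts]

theorem matchedVerts_mono {V : Type*} {M N : Set (Sym2 V)} (h : N ⊆ M) :
    matchedVerts N ⊆ matchedVerts M := fun _ ⟨e, he, hx⟩ => ⟨e, h he, hx⟩

theorem IsAcyclicMatching.mono {V : Type*} {G : SimpleGraph V} {M N : Set (Sym2 V)}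
    (hM : IsAcyclicMatching G M) (h : N ⊆ M) : IsAcyclicMatching G N := by
  refine ⟨⟨h.trans hM.1.1, fun e he f hf => hM.1.2 e (h he) f (h hf)⟩, ?_⟩
  rw [acyclic_induce_iff]
  intro v c hc
  obtain ⟨x, hx, hxM⟩ := acyclic_induce_iff.1 hM.2 v c hc
  exact ⟨x, hx, fun hxN => hxM (matchedVerts_mono h hxN)⟩

theorem IsMatchingSet.notMem_matchedVerts_diff {V : Type*} {G : SimpleGraph V} {M : Set (Sym2 V)}
    (hM : IsMatchingSet G M) {e : Sym2 V} (he : e ∈ M) {x : V} (hx : x ∈ e) :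
    x ∉ matchedVerts (M \ {e}) := by
  rintro ⟨f, ⟨hf, hfe⟩, hxf⟩
  exact hM.2 e he f hf (Ne.symm hfe) x hx hxf

theorem IsMatchingSet.exists_adj {V : Type*} {G : SimpleGraph V} {M : Set (Sym2 V)}
    (hM : IsMatchingSet G M) {x : V} (hx : x ∈ matchedVerts M) :
    ∃ y, G.Adj x y ∧ s(x, y) ∈ M := by
  obtain ⟨e, he, y, rfl⟩ := hx
  exact ⟨y, hM.1 he, he⟩

theorem IsMatchingSet.insert {V : Type*} {G : SimpleGraph V} {M : Set (Sym2 V)}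
    (hM : IsMatchingSet G M) {p q : V} (hpq : G.Adj p q) (hp : p ∉ matchedVerts M)
    (hq : q ∉ matchedVerts M) : IsMatchingSet G (insert s(p, q) M) := by
  have key : ∀ f ∈ M, ∀ v ∈ s(p, q), v ∉ f := by
    intro f hf v hv hvf
    rcases Sym2.mem_iff.1 hv with rfl | rfl
    · exact hp ⟨f, hf, hvf⟩
    · exact hq ⟨f, hf, hvf⟩
  refine ⟨Set.insert_subset hpq hM.1, ?_⟩
  rintro e (rfl | he) f (rfl | hf) hne v hve
  · exact absurd rfl hne
  · exact key f hf v hve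
  · exact fun hv => key e he v hv hve
  · exact hM.2 e he f hf hne v hve

/-- Adding a pendant path `q - p` keeps a matching acyclic. -/
theorem IsAcyclicMatching.insert_pendant {V : Type*} {G : SimpleGraph V} {M : Set (Sym2 V)}
    (hM : IsAcyclicMatching G M) {p q v w : V} (hpq : G.Adj p q) (hp : p ∉ matchedVerts M)
    (hq : q ∉ matchedVerts M) (hp_adj : ∀ x, G.Adj p x → x = v ∨ x = q)
    (hq_adj : ∀ x, G.Adj q x → x = p ∨ x = w)
    (hvp : v ≠ p) (hv : v ∉ matchedVerts M) :
    IsAcyclicMatching G (insert s(p, q) M) := by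
  refine ⟨hM.1.insert hpq hp hq, acyclic_induce_iff.2 fun u c hc => ?_⟩
  by_contra! hS
  simp only [matchedVerts_insert, Sym2.mem_iff] at hS
  have hpc : p ∉ c.support := fun hpc => by
    obtain ⟨y, hy, hpy, hyq⟩ := hc.exists_adj_ne hpc q
    have := hp_adj y hpy
    have := hS y hy
    grind
  have hqc : q ∉ c.support := fun hqc => by
    obtain ⟨y, hy, hqy, hyw⟩ := hc.exists_adj_ne hqc w
    have := hq_adj y hqy
    grind
  obtain ⟨x, hx, hxM⟩ := acyclic_induce_iff.1 hM.2 u c hc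
  have := hS x hx
  grind

/-- Given a XOR gadget on `v₁, v₂` with private vertices `p₁, p₂`, any maximum acyclic
matching can be modified, keeping its size, so that it contains the edge `{p₁,p₂}` and
covers at most one of `v₁, v₂`. -/
theorem xor_gadget_normalize {V : Type*} [Fintype V] (G : SimpleGraph V)
    (v₁ v₂ p₁ p₂ : V)
    (h12 : v₁ ≠ v₂) (h1p1 : v₁ ≠ p₁) (h1p2 : v₁ ≠ p₂)
    (h2p1 : v₂ ≠ p₁) (h2p2 : v₂ ≠ p₂) (hp12 : p₁ ≠ p₂)
    (e1 : G.Adj v₁ v₂) (e2 : G.Adj v₁ p₁) (e3 : G.Adj p₁ p₂) (e4 : G.Adj p₂ v₂)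
    (hp1 : ∀ x : V, G.Adj p₁ x ↔ (x = v₁ ∨ x = p₂))
    (hp2 : ∀ x : V, G.Adj p₂ x ↔ (x = p₁ ∨ x = v₂))
    (M : Set (Sym2 V)) (hM : IsAcyclicMatching G M)
    (hmax : ∀ M'' : Set (Sym2 V), IsAcyclicMatching G M'' → M''.ncard ≤ M.ncard) :
    ∃ M' : Set (Sym2 V), IsAcyclicMatching G M' ∧ M'.ncard = M.ncard ∧
      s(p₁, p₂) ∈ M' ∧ ¬(v₁ ∈ matchedVerts M' ∧ v₂ ∈ matchedVerts M') := by
  have hcycle : ¬(v₁ ∈ matchedVerts M ∧ v₂ ∈ matchedVerts M ∧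
      p₁ ∈ matchedVerts M ∧ p₂ ∈ matchedVerts M) := by
    rintro ⟨hv1, hv2, hq1, hq2⟩
    obtain ⟨c, hc, hsupp⟩ := exists_cycle_four h1p2 h2p1 e1 e4.symm e3.symm e2.symm
    obtain ⟨x, hx, hxM⟩ := acyclic_induce_iff.1 hM.2 _ c hc
    grind
  by_cases hpM : s(p₁, p₂) ∈ M
  · exact ⟨M, hM, rfl, hpM, fun h => hcycle
      ⟨h.1, h.2, ⟨_, hpM, Sym2.mem_mk_left _ _⟩, ⟨_, hpM, Sym2.mem_mk_right _ _⟩⟩⟩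
  have hp1M : p₁ ∈ matchedVerts M → s(v₁, p₁) ∈ M := fun h => by
    obtain ⟨y, hy, hyM⟩ := hM.1.exists_adj h
    rcases (hp1 y).1 hy with rfl | rfl
    · rwa [Sym2.eq_swap]
    · exact absurd hyM hpM
  have hp2M : p₂ ∈ matchedVerts M → s(v₂, p₂) ∈ M := fun h => by
    obtain ⟨y, hy, hyM⟩ := hM.1.exists_adj h
    rcases (hp2 y).1 hy with rfl | rfl
    · exact absurd (Sym2.eq_swap ▸ hyM) hpM
    · rwa [Sym2.eq_swap]
  obtain ⟨N, hNM, hcard, hq1, hq2, hv⟩ : ∃ N ⊆ M, M.ncard ≤ N.ncard + 1 ∧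
      p₁ ∉ matchedVerts N ∧ p₂ ∉ matchedVerts N ∧
      (v₁ ∉ matchedVerts N ∨ v₂ ∉ matchedVerts N) := by
    have hmem {x : V} {e : Sym2 V} (he : e ∈ M) (hx : x ∈ e) : x ∈ matchedVerts M := ⟨e, he, hx⟩
    have hsub (e : Sym2 V) : matchedVerts (M \ {e}) ⊆ matchedVerts M :=
      matchedVerts_mono Set.sdiff_subset
    have hdiff (e : Sym2 V) : M.ncard ≤ (M \ {e}).ncard + 1 := by
      simpa using Set.ncard_le_ncard_sdiff_add_ncard M {e}
    by_cases h2 : p₂ ∈ matchedVerts M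
    · have he := hp2M h2
      have hrm {x : V} (hx : x ∈ s(v₂, p₂)) := hM.1.notMem_matchedVerts_diff he hx
      refine ⟨M \ {s(v₂, p₂)}, Set.sdiff_subset, hdiff _, fun h1 => ?_, hrm (by simp),
        .inr (hrm (by simp))⟩
      have h1' := hsub _ h1
      exact hcycle ⟨hmem (hp1M h1') (by simp), hmem he (by simp), h1', h2⟩
    · by_cases h1 : v₁ ∈ matchedVerts M
      · obtain ⟨e, he, hve⟩ := h1
        refine ⟨M \ {e}, Set.sdiff_subset, hdiff _, fun h => ?_, fun h => h2 (hsub _ h),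
          .inl (hM.1.notMem_matchedVerts_diff he hve)⟩
        have hpe := hp1M (hsub _ h)
        obtain rfl : e = s(v₁, p₁) := by
          by_contra hne
          exact hM.1.2 e he _ hpe hne v₁ hve (by simp)
        exact hM.1.notMem_matchedVerts_diff he (by simp) h
      · exact ⟨M, subset_rfl, by omega, fun h => h1 (hmem (hp1M h) (by simp)), h2, .inl h1⟩
  have hins : IsAcyclicMatching G (insert s(p₁, p₂) N) := by
    rcases hv with hv | hv
    · exact (hM.mono hNM).insert_pendant e3 hq1 hq2 (fun x => (hp1 x).1) (fun x => (hp2 x).1)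
        h1p1 hv
    · rw [Sym2.eq_swap]
      exact (hM.mono hNM).insert_pendant e3.symm hq2 hq1 (fun x h => ((hp2 x).1 h).symm)
        (fun x h => ((hp1 x).1 h).symm) h2p2 hv
  refine ⟨_, hins, (hmax _ hins).antisymm ?_, Set.mem_insert _ _, ?_⟩
  · rwa [Set.ncard_insert_of_notMem fun h => hpM (hNM h)]
  · simp only [matchedVerts_insert, Sym2.mem_iff]
    tauto
end

section
/- Let G be a finite simple graph, W a subset of V(G), and lab : W → {1,…,k} a labeling such that same-labeled vertices have the same neighbors outside W, i.e., for all v, v' ∈ W with lab(v) = lab(v') and all u ∈ V(G) ∖ W, if {v,u} is an edge of G then {v',u} is an edge of G. Let M be an acyclic matching of G and set S = V_M ∩ W. Then for every label i ∈ {1,…,k}, at most one vertex of S ∩ lab⁻¹(i) is matched by M to a vertex lying outside W. -/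
/-- For an acyclic matching `M` and a labeling of `W ⊆ V(G)` where same-labeled vertices
have the same neighborhood outside `W`, each label class of `S = V_M ∩ W` contains at most
one vertex matched by `M` to a vertex outside `W`. -/
theorem acyclicMatching_at_most_one_matched_outside
    {V : Type*} [Fintype V] {k : ℕ} (G : SimpleGraph V) (W : Set V) (lab : V → Fin k)
    (hlab : ∀ v v' : V, v ∈ W → v' ∈ W → lab v = lab v' →
      ∀ u : V, u ∉ W → G.Adj v u → G.Adj v' u)
    (M : Set (Sym2 V)) (hM : IsAcyclicMatching G M) :
    ∀ i : Fin k,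
      {x : V | x ∈ matchedVerts M ∩ W ∧ lab x = i ∧
        ∃ u : V, u ∉ W ∧ s(x, u) ∈ M}.Subsingleton := by
  rintro i x ⟨⟨hxM, hxW⟩, hxi, u, huW, hxu⟩ y ⟨⟨hyM, hyW⟩, hyi, w, hwW, hyw⟩
  by_contra hxy
  obtain ⟨⟨hsub, hmatch⟩, hacyc⟩ := hM
  have hlxy : lab x = lab y := hxi.trans hyi.symm
  have hxu' : G.Adj x u := hsub hxu
  have hyw' : G.Adj y w := hsub hyw
  have hyu : G.Adj y u := hlab x y hxW hyW hlxy u huW hxu'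
  have hxw : G.Adj x w := hlab y x hyW hxW hlxy.symm w hwW hyw'
  have hxw_ne : x ≠ w := fun h => hwW (h ▸ hxW)
  have hyu_ne : y ≠ u := fun h => huW (h ▸ hyW)
  have hxu_ne : x ≠ u := hxu'.ne
  have hyw_ne : y ≠ w := hyw'.ne
  have huw : u ≠ w := by
    rintro rfl
    refine hmatch _ hxu _ hyw ?_ u (Sym2.mem_mk_right _ _) (Sym2.mem_mk_right _ _)
    simp [hxy, hxu_ne]
  have huM : u ∈ matchedVerts M := ⟨_, hxu, Sym2.mem_mk_right _ _⟩
  have hwM : w ∈ matchedVerts M := ⟨_, hyw, Sym2.mem_mk_right _ _⟩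
  let H := G.induce (matchedVerts M)
  have h₁ : H.Adj ⟨x, hxM⟩ ⟨u, huM⟩ := hxu'
  have h₂ : H.Adj ⟨u, huM⟩ ⟨y, hyM⟩ := hyu.symm
  have h₃ : H.Adj ⟨y, hyM⟩ ⟨w, hwM⟩ := hyw'
  have h₄ : H.Adj ⟨w, hwM⟩ ⟨x, hxM⟩ := hxw.symm
  refine hacyc (.cons h₁ (.cons h₂ (.cons h₃ (.cons h₄ .nil)))) ?_
  rw [SimpleGraph.Walk.cons_isCycle_iff]
  simp [SimpleGraph.Walk.cons_isPath_iff, hxy, Ne.symm hxy, huw, hxw_ne, hxw_ne.symm,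
    hyu_ne.symm, hxu_ne, hxu_ne.symm, hyw_ne]
end

section
/- Let G be a finite simple graph, W a subset of V(G), and lab : W → {1,…,k} a labeling such that same-labeled vertices have the same neighbors outside W, i.e., for all v, v' ∈ W with lab(v) = lab(v') and all u ∈ V(G) ∖ W, if {v,u} is an edge of G then {v',u} is an edge of G. Let M be an acyclic matching of G and set S = V_M ∩ W. If for some label i ∈ {1,…,k} there is a vertex of S ∩ lab⁻¹(i) that is matched by M to a vertex lying outside W, then every connected component of the induced subgraph G[S] contains at most one vertex of S ∩ lab⁻¹(i); that is, distinct vertices of S ∩ lab⁻¹(i) lie in distinct connected components of G[S]. -/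
/-- In an acyclic induced subgraph on `A`, two distinct vertices of `B ⊆ A` having a common neighbor
in `A \ B` are not reachable from each other within `B`. -/
theorem eq_of_reachable_induce_of_common_adj {V : Type*} {G : SimpleGraph V} {A B : Set V}
    (hBA : B ⊆ A) (hA : (G.induce A).IsAcyclic) {x y u : V} (hx : x ∈ B) (hy : y ∈ B)
    (huA : u ∈ A) (huB : u ∉ B) (hxu : G.Adj x u) (hyu : G.Adj y u)
    (hr : (G.induce B).Reachable ⟨x, hx⟩ ⟨y, hy⟩) : x = y := by
  by_contra hne
  obtain ⟨p, hp⟩ := hr.exists_isPath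
  let f := SimpleGraph.induceHomOfLE G hBA
  have hq : (p.map f.toHom).IsPath := hp.map f.injective
  have hxu' : (G.induce A).Adj ⟨x, hBA hx⟩ ⟨u, huA⟩ := hxu
  have huy' : (G.induce A).Adj ⟨u, huA⟩ ⟨y, hBA hy⟩ := hyu.symm
  let w := SimpleGraph.Walk.cons hxu' (SimpleGraph.Walk.cons huy' SimpleGraph.Walk.nil)
  have hw : w.IsPath := by
    simp [w, SimpleGraph.Walk.isPath_def, hxu.ne, hyu.ne', hne]
  have h : p.map f.toHom = w :=
    congrArg Subtype.val ((hA.subsingleton_path _ _).elim ⟨_, hq⟩ ⟨w, hw⟩)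
  have hu : (⟨u, huA⟩ : A) ∈ (p.map f.toHom).support := by
    rw [h]
    exact List.mem_cons_of_mem _ List.mem_cons_self
  rw [SimpleGraph.Walk.support_map, List.mem_map] at hu
  obtain ⟨a, -, ha⟩ := hu
  have hau : (a : V) = u := congrArg Subtype.val ha
  exact huB (hau ▸ a.2)

/-- For an acyclic matching `M` and a labeling of `W ⊆ V(G)` where same-labeled vertices
have the same neighborhood outside `W`: if some vertex of label `i` in `S = V_M ∩ W` is
matched to a vertex outside `W`, then distinct vertices of label `i` in `S` lie in distinct
connected components of `G[S]`. -/
theorem acyclicMatching_label_class_distinct_components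
    {V : Type*} [Fintype V] {k : ℕ} (G : SimpleGraph V) (W : Set V) (lab : V → Fin k)
    (hlab : ∀ v v' : V, v ∈ W → v' ∈ W → lab v = lab v' →
      ∀ u : V, u ∉ W → G.Adj v u → G.Adj v' u)
    (M : Set (Sym2 V)) (hM : IsAcyclicMatching G M) (i : Fin k)
    (hex : ∃ x ∈ matchedVerts M ∩ W, lab x = i ∧ ∃ u : V, u ∉ W ∧ s(x, u) ∈ M) :
    ∀ (x y : V) (hx : x ∈ matchedVerts M ∩ W) (hy : y ∈ matchedVerts M ∩ W),
      lab x = i → lab y = i →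
      (G.induce (matchedVerts M ∩ W)).Reachable ⟨x, hx⟩ ⟨y, hy⟩ → x = y := by
  intro x y hx hy hxi hyi hr
  obtain ⟨z, hz, hzi, u, huW, hzu⟩ := hex
  have hadj : G.Adj z u := hM.1.1 hzu
  exact eq_of_reachable_induce_of_common_adj Set.inter_subset_left hM.2 hx hy
    ⟨s(z, u), hzu, Sym2.mem_mk_right z u⟩ (fun h ↦ huW h.2)
    (hlab z x hz.2 hx.2 (hzi.trans hxi.symm) u huW hadj)
    (hlab z y hz.2 hy.2 (hzi.trans hyi.symm) u huW hadj) hr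
end

section
/- Let L be a finite set. For all partitions p, q, r of L it holds that acy(p,q) ∧ acy(p⊔q, r) if and only if acy(q,r) ∧ acy(p, q⊔r), where acy(p,q) holds exactly when |L| + block(p⊔q) − (block(p) + block(q)) = 0. -/
/-- The number of blocks of a partition of `L`, viewed as a setoid on `L`. -/
noncomputable def nblocks {L : Type*} (p : Setoid L) : ℕ := Nat.card (Quotient p)

/-- `acy(p,q)` holds iff `|L| + block(p ⊔ q) − (block(p) + block(q)) = 0`, where `⊔` is the
join in the lattice of partitions (setoids) of `L`. -/
def acy {L : Type*} (p q : Setoid L) : Prop :=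
  (Nat.card L : ℤ) + nblocks (p ⊔ q) - (nblocks p + nblocks q) = 0

/-- The space of rational-valued functions on `L` that are constant on the blocks of `p`. -/
def blockFunctions {L : Type*} (p : Setoid L) : Submodule ℚ (L → ℚ) :=
  LinearMap.range (LinearMap.funLeft ℚ ℚ (Quotient.mk p))

lemma mem_blockFunctions {L : Type*} {p : Setoid L} {f : L → ℚ} :
    f ∈ blockFunctions p ↔ p ≤ Setoid.ker f := by
  constructor
  · rintro ⟨g, rfl⟩ x y h
    exact congrArg g (Quotient.sound h)
  · intro h
    exact ⟨Quotient.lift f fun _ _ hab => h hab, rfl⟩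

lemma blockFunctions_sup {L : Type*} (p q : Setoid L) :
    blockFunctions (p ⊔ q) = blockFunctions p ⊓ blockFunctions q := by
  ext f
  simp only [Submodule.mem_inf, mem_blockFunctions, sup_le_iff]

lemma finrank_blockFunctions {L : Type*} [Finite L] (p : Setoid L) :
    Module.finrank ℚ (blockFunctions p) = nblocks p := by
  have := Fintype.ofFinite (Quotient p)
  rw [blockFunctions, LinearMap.finrank_range_of_inj
    (LinearMap.funLeft_injective_of_surjective _ _ _ Quotient.mk_surjective),
    Module.finrank_fintype_fun_eq_card, nblocks, Nat.card_eq_fintype_card]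

lemma nblocks_add_nblocks_le {L : Type*} [Finite L] (p q : Setoid L) :
    nblocks p + nblocks q ≤ Nat.card L + nblocks (p ⊔ q) := by
  have := Fintype.ofFinite L
  have h := Submodule.finrank_sup_add_finrank_inf_eq (blockFunctions p) (blockFunctions q)
  have hle := Submodule.finrank_le (blockFunctions p ⊔ blockFunctions q)
  rw [← blockFunctions_sup] at h
  simp only [finrank_blockFunctions] at h
  rw [Module.finrank_fintype_fun_eq_card, ← Nat.card_eq_fintype_card] at hle
  omega

/-- For all partitions `p, q, r` of a finite set `L`:
`acy(p,q) ∧ acy(p⊔q, r) ↔ acy(q,r) ∧ acy(p, q⊔r)`. -/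
theorem acy_assoc {L : Type*} [Fintype L] (p q r : Setoid L) :
    (acy p q ∧ acy (p ⊔ q) r) ↔ (acy q r ∧ acy p (q ⊔ r)) := by
  have h₁ := nblocks_add_nblocks_le p q
  have h₂ := nblocks_add_nblocks_le (p ⊔ q) r
  have h₃ := nblocks_add_nblocks_le q r
  have h₄ := nblocks_add_nblocks_le p (q ⊔ r)
  unfold acy
  rw [sup_assoc] at h₂ ⊢
  omega
end

section
/- Let L be a finite set and let F_p = (L, E_p) and F_q = (L, E_q) be forests (acyclic simple graphs) on the common vertex set L. Let p ∈ Π(L) be the partition of L into the connected components of F_p, and q ∈ Π(L) the partition of L into the connected components of F_q. Then acy(p,q) holds if and only if E_p ∩ E_q = ∅ and the graph (L, E_p ∪ E_q) is a forest. -/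
namespace SimpleGraph

variable {V : Type*}

/-- A finite forest has as many vertices as it has edges and connected components together. -/
lemma IsAcyclic.ncard_edgeSet_add_card_connectedComponent [Finite V] {G : SimpleGraph V}
    (hG : G.IsAcyclic) : G.edgeSet.ncard + Nat.card G.ConnectedComponent = Nat.card V := by
  classical
  have := Fintype.ofFinite V
  have hdeg (c : G.ConnectedComponent) (v : c) : c.toSimpleGraph.degree v = G.degree v := by
    have hsub : G.neighborSet v ⊆ c.supp := fun w hw ↦ c.mem_supp_of_adj_mem_supp v.2 hw
    convert degree_induce_of_neighborSet_subset (v := (⟨v, v.2⟩ : c.supp)) hsub <;> rfl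
  have htree (c : G.ConnectedComponent) :
      ∑ v : c, G.degree v + 2 = 2 * Fintype.card c := by
    have hedges := (hG.isTree_connectedComponent c).card_edgeFinset
    have hdegrees := c.toSimpleGraph.sum_degrees_eq_twice_card_edges
    simp only [hdeg] at hdegrees
    omega
  let e : (Σ c : G.ConnectedComponent, c) ≃ V := Equiv.sigmaFiberEquiv G.connectedComponentMk
  have hsum : ∑ c : G.ConnectedComponent, ∑ v : c, G.degree v = ∑ v, G.degree v := by
    rw [← Fintype.sum_sigma', ← e.sum_comp]
    rfl
  have hcard : ∑ c : G.ConnectedComponent, Fintype.card c = Fintype.card V := by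
    rw [← Fintype.card_sigma, Fintype.card_congr e]
  have htotal := Finset.sum_congr (rfl : Finset.univ = Finset.univ) fun c _ ↦ htree c
  rw [Finset.sum_add_distrib, hsum, ← Finset.mul_sum, hcard,
    sum_degrees_eq_twice_card_edges] at htotal
  simp only [Finset.sum_const, Finset.card_univ, smul_eq_mul] at htotal
  rw [← coe_edgeFinset, Set.ncard_coe_finset, Nat.card_eq_fintype_card,
    Nat.card_eq_fintype_card]
  omega

/-- A finite graph is a forest if and only if it has as many vertices as it has edges and
connected components together. -/
lemma isAcyclic_iff_ncard_edgeSet_add_card_connectedComponent [Finite V] (G : SimpleGraph V) :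
    G.IsAcyclic ↔ G.edgeSet.ncard + Nat.card G.ConnectedComponent = Nat.card V := by
  refine ⟨fun h ↦ h.ncard_edgeSet_add_card_connectedComponent, fun h ↦ ?_⟩
  obtain ⟨F, hle, hF, hreach⟩ := G.exists_isAcyclic_reachable_eq_le
  have hcard := hF.ncard_edgeSet_add_card_connectedComponent
  unfold ConnectedComponent at h hcard
  rw [hreach] at hcard
  have hedge : F.edgeSet = G.edgeSet :=
    Set.eq_of_subset_of_ncard_le (edgeSet_mono hle) (by omega) (Set.toFinite _)
  rwa [← edgeSet_inj.mp hedge]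

/-- In a finite graph, edges and connected components together are at least as many as the
vertices. -/
lemma card_le_ncard_edgeSet_add_card_connectedComponent [Finite V] (G : SimpleGraph V) :
    Nat.card V ≤ G.edgeSet.ncard + Nat.card G.ConnectedComponent := by
  obtain ⟨F, hle, hF, hreach⟩ := G.exists_isAcyclic_reachable_eq_le
  have hcard := hF.ncard_edgeSet_add_card_connectedComponent
  unfold ConnectedComponent at hcard ⊢
  rw [hreach] at hcard
  have := Set.ncard_le_ncard (edgeSet_mono hle) (Set.toFinite _)
  omega

lemma reachableSetoid_sup (G H : SimpleGraph V) :
    (G ⊔ H).reachableSetoid = G.reachableSetoid ⊔ H.reachableSetoid := by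
  refine le_antisymm ?_ (sup_le (fun _ _ h ↦ Reachable.mono le_sup_left h)
    fun _ _ h ↦ Reachable.mono le_sup_right h)
  rintro u v ⟨w⟩
  induction w with
  | nil => exact Setoid.refl' _ _
  | cons h _ ih =>
    refine Setoid.trans' _ ?_ ih
    rcases h with h | h
    · exact (le_sup_left : G.reachableSetoid ≤ _) h.reachable
    · exact (le_sup_right : H.reachableSetoid ≤ _) h.reachable

end SimpleGraph

lemma nblocks_reachableSetoid {L : Type*} (G : SimpleGraph L) :
    nblocks G.reachableSetoid = Nat.card G.ConnectedComponent := rfl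

/-- If `F_p` and `F_q` are forests on the common vertex set `L`, with `p` and `q` the
partitions of `L` into their connected components, then `acy(p,q)` holds iff the edge sets
are disjoint and the union of the two forests is again a forest. -/
theorem acy_iff_union_forest {L : Type*} [Fintype L] (Fp Fq : SimpleGraph L)
    (hFp : Fp.IsAcyclic) (hFq : Fq.IsAcyclic) :
    acy Fp.reachableSetoid Fq.reachableSetoid ↔
      (Fp.edgeSet ∩ Fq.edgeSet = ∅ ∧ (Fp ⊔ Fq).IsAcyclic) := by
  rw [acy, ← SimpleGraph.reachableSetoid_sup]
  simp only [nblocks_reachableSetoid]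
  have hp := hFp.ncard_edgeSet_add_card_connectedComponent
  have hq := hFq.ncard_edgeSet_add_card_connectedComponent
  have hle := (Fp ⊔ Fq).card_le_ncard_edgeSet_add_card_connectedComponent
  have hunion := Set.ncard_union_add_ncard_inter Fp.edgeSet Fq.edgeSet
  rw [SimpleGraph.isAcyclic_iff_ncard_edgeSet_add_card_connectedComponent,
    ← Set.ncard_eq_zero (Set.toFinite _)]
  rw [SimpleGraph.edgeSet_sup] at hle ⊢
  omega
end
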